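/- There exist a foliation F and a Riemannian metric g on the solid torus D² × S¹ such that: (1) F is parabolic with respect to g; and (2) the restriction of F to D²(1/3) × S¹ is the foliation by disks D²(1/3) × {t} which are totally geodesic, and the restriction of F to the collar ([2/3,1] × S¹) × S¹ is the foliation by tori {r} × S¹ × S¹ which are totally geodesic. The foliation F is a 'thick' Reeb foliation: there is a subset N of the solid torus such that F restricted to N is a Reeb foliation and F restricted to the complement of N is diffeomorphic to a product foliation by tori. -/

import Mathlib

open Set

noncomputable section

/-! ### Extrinsic geometry on the solid torus `D² × S¹`

We realize the solid torus as the subset `D² × S¹ ⊆ ℂ × ℂ` and develop the extrinsic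
geometry of plane fields on it using derivatives within this set. A point of the solid torus
is `p = (z, w)` with `‖z‖ ≤ 1` (the disk coordinate, with `r = ‖z‖`, `φ = arg z`) and
`‖w‖ = 1` (the `S¹`-coordinate `t`). -/

/-- The solid torus `D² × S¹ ⊆ ℂ × ℂ`. -/
def SolidTorus : Set (ℂ × ℂ) := {p | ‖p.1‖ ≤ 1 ∧ ‖p.2‖ = 1}

/-- The real inner product `⟪z, ·⟫_ℝ = re (z̄ ·)` on `ℂ`, as an `ℝ`-linear map. -/
def rIPL (z : ℂ) : ℂ →ₗ[ℝ] ℝ :=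
  Complex.reLm.comp ((LinearMap.mulLeft ℝ (starRingEnd ℂ z)).restrictScalars ℝ)

/-- The tangent space of the solid torus at `p`: all vectors whose second component is
tangent to the circle `S¹` at `p.2` (the first component is unconstrained; at boundary
points of `D²` the tangent space of a manifold with boundary is still the full space). -/
def STtan (p : ℂ × ℂ) : Submodule ℝ (ℂ × ℂ) :=
  LinearMap.ker ((rIPL p.2).comp (LinearMap.snd ℝ ℂ ℂ))

/-- A smooth function on the solid torus. -/
def SmoothFST (f : ℂ × ℂ → ℝ) : Prop := ContDiffOn ℝ (⊤ : ℕ∞) f SolidTorus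

/-- A smooth vector field on the solid torus: smooth and everywhere tangent. -/
def SmoothVFST (V : ℂ × ℂ → ℂ × ℂ) : Prop :=
  ContDiffOn ℝ (⊤ : ℕ∞) V SolidTorus ∧ ∀ p ∈ SolidTorus, V p ∈ STtan p

/-- A Riemannian metric on the solid torus. -/
structure RMetricST : Type where
  g : ℂ × ℂ → (ℂ × ℂ) →ₗ[ℝ] (ℂ × ℂ) →ₗ[ℝ] ℝ
  symm : ∀ p ∈ SolidTorus, ∀ u v, g p u v = g p v u
  posdef : ∀ p ∈ SolidTorus, ∀ v ∈ STtan p, v ≠ 0 → 0 < g p v v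
  smooth : ∀ V W, SmoothVFST V → SmoothVFST W →
    ContDiffOn ℝ (⊤ : ℕ∞) (fun p => g p (V p) (W p)) SolidTorus

/-- The Levi-Civita connection of a Riemannian metric on the solid torus: a connection
(additive, tensorial in the first argument, Leibniz in the second, preserving tangency),
compatible with the metric and torsion-free. -/
structure LeviCivitaST (gm : RMetricST) : Type where
  cov : (ℂ × ℂ → ℂ × ℂ) → (ℂ × ℂ → ℂ × ℂ) → (ℂ × ℂ → ℂ × ℂ)
  smooth_cov : ∀ X Y, SmoothVFST X → SmoothVFST Y → SmoothVFST (cov X Y)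
  add_left : ∀ X X' Y, ∀ p ∈ SolidTorus,
    cov (fun q => X q + X' q) Y p = cov X Y p + cov X' Y p
  smul_left : ∀ (f : ℂ × ℂ → ℝ) (X Y), SmoothFST f → SmoothVFST X → SmoothVFST Y →
    ∀ p ∈ SolidTorus, cov (fun q => f q • X q) Y p = f p • cov X Y p
  add_right : ∀ X Y Y', ∀ p ∈ SolidTorus,
    cov X (fun q => Y q + Y' q) p = cov X Y p + cov X Y' p
  leibniz : ∀ (f : ℂ × ℂ → ℝ) (X Y), SmoothFST f → SmoothVFST X → SmoothVFST Y →
    ∀ p ∈ SolidTorus, cov X (fun q => f q • Y q) p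
      = f p • cov X Y p + (fderivWithin ℝ f SolidTorus p (X p)) • Y p
  compat : ∀ X Y Z, SmoothVFST X → SmoothVFST Y → SmoothVFST Z → ∀ p ∈ SolidTorus,
    fderivWithin ℝ (fun q => gm.g q (Y q) (Z q)) SolidTorus p (X p)
      = gm.g p (cov X Y p) (Z p) + gm.g p (Y p) (cov X Z p)
  torsion_free : ∀ X Y, SmoothVFST X → SmoothVFST Y → ∀ p ∈ SolidTorus,
    cov X Y p - cov Y X p
      = fderivWithin ℝ Y SolidTorus p (X p) - fderivWithin ℝ X SolidTorus p (Y p)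

/-- The second fundamental form `B(S,T) = ½(⟨∇_S T, n⟩ + ⟨∇_T S, n⟩)` of a plane field with
unit normal `n` on the solid torus. -/
def sffST (gm : RMetricST) (lc : LeviCivitaST gm) (n : ℂ × ℂ → ℂ × ℂ)
    (S T : ℂ × ℂ → ℂ × ℂ) (p : ℂ × ℂ) : ℝ :=
  (gm.g p (lc.cov S T p) (n p) + gm.g p (lc.cov T S p) (n p)) / 2

/-- `n` is a smooth unit normal field of the plane field `ξ` on the solid torus. -/
def IsUnitNormalST (gm : RMetricST) (ξ : ℂ × ℂ → Submodule ℝ (ℂ × ℂ))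
    (n : ℂ × ℂ → ℂ × ℂ) : Prop :=
  SmoothVFST n ∧ ∀ p ∈ SolidTorus, gm.g p (n p) (n p) = 1 ∧ ∀ v ∈ ξ p, gm.g p (n p) v = 0

/-- The extrinsic curvature of the plane field `ξ` equals `k`: for all local smooth sections
`S`, `T` of `ξ` linearly independent at `p`,
`B(S,S)B(T,T) - B(S,T)² = k (⟨S,S⟩⟨T,T⟩ - ⟨S,T⟩²)` at `p`. -/
def ExtCurvEqST (gm : RMetricST) (lc : LeviCivitaST gm) (n : ℂ × ℂ → ℂ × ℂ)
    (ξ : ℂ × ℂ → Submodule ℝ (ℂ × ℂ)) (k : ℂ × ℂ → ℝ) : Prop :=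
  ∀ p ∈ SolidTorus, ∀ U : Set (ℂ × ℂ), IsOpen U → p ∈ U →
    ∀ S T, SmoothVFST S → SmoothVFST T →
      (∀ y ∈ SolidTorus ∩ U, S y ∈ ξ y) → (∀ y ∈ SolidTorus ∩ U, T y ∈ ξ y) →
      LinearIndependent ℝ ![S p, T p] →
      sffST gm lc n S S p * sffST gm lc n T T p - (sffST gm lc n S T p) ^ 2
        = k p * (gm.g p (S p) (S p) * gm.g p (T p) (T p) - (gm.g p (S p) (T p)) ^ 2)

/-- The plane field `ξ` is totally geodesic at `p`: the second fundamental form vanishes at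
`p` on all local smooth sections of `ξ` near `p`. -/
def TotallyGeodesicAtST (gm : RMetricST) (lc : LeviCivitaST gm) (n : ℂ × ℂ → ℂ × ℂ)
    (ξ : ℂ × ℂ → Submodule ℝ (ℂ × ℂ)) (p : ℂ × ℂ) : Prop :=
  ∀ U : Set (ℂ × ℂ), IsOpen U → p ∈ U →
    ∀ S T, SmoothVFST S → SmoothVFST T →
      (∀ y ∈ SolidTorus ∩ U, S y ∈ ξ y) → (∀ y ∈ SolidTorus ∩ U, T y ∈ ξ y) →
      sffST gm lc n S T p = 0

/-- The 1-form `α = f(r) dr + (1 - f(r)) dt` on the solid torus (at `p = (z,w)`: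
`dr = ⟪z/‖z‖, ·⟫` on the first factor and `dt = ⟪i w, ·⟫` on the second factor). -/
def reebForm (f : ℝ → ℝ) (p : ℂ × ℂ) : (ℂ × ℂ) →ₗ[ℝ] ℝ :=
  (f ‖p.1‖ / ‖p.1‖) • (rIPL p.1).comp (LinearMap.fst ℝ ℂ ℂ)
    + (1 - f ‖p.1‖) • (rIPL (Complex.I * p.2)).comp (LinearMap.snd ℝ ℂ ℂ)

/-- The 'thick' Reeb foliation of the solid torus determined by `f`: the plane field
`ker (f(r) dr + (1 - f(r)) dt)` tangent to the solid torus. -/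
def reebPlanes (f : ℝ → ℝ) (p : ℂ × ℂ) : Submodule ℝ (ℂ × ℂ) :=
  STtan p ⊓ LinearMap.ker (reebForm f p)

theorem rIPL_apply (a b : ℂ) : rIPL a b = inner ℝ a b := by
  simp [rIPL, Complex.inner, mul_comm]

theorem complex_inner_eq (a b : ℂ) : inner ℝ a b = a.re * b.re + a.im * b.im := by
  simp [Complex.inner]; ring

theorem mem_STtan {p v : ℂ × ℂ} : v ∈ STtan p ↔ inner ℝ p.2 v.2 = 0 := by
  simp [STtan, rIPL_apply]

theorem norm_sq_eq_one_re_im {w : ℂ} (hw : ‖w‖ = 1) : w.re * w.re + w.im * w.im = 1 := by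
  rw [← complex_inner_eq, real_inner_self_eq_norm_sq, hw, one_pow]

/-- A vector orthogonal to the unit vector `w` is a multiple of `I * w`. -/
theorem eq_smul_I_mul_of_inner_eq_zero {w u : ℂ} (hw : ‖w‖ = 1) (hu : inner ℝ w u = 0) :
    u = (inner ℝ (Complex.I * w) u : ℝ) • (Complex.I * w) := by
  have h := norm_sq_eq_one_re_im hw
  rw [complex_inner_eq] at hu
  apply Complex.ext
  · simp
    linear_combination (-u.re) * h + w.re * hu
  · simp
    linear_combination (-u.im) * h + w.im * hu

theorem hasFDerivWithinAt_solidTorus_unique {F : Type*} [NormedAddCommGroup F] [NormedSpace ℝ F]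
    {f : ℂ × ℂ → F} {f₁ f₂ : ℂ × ℂ →L[ℝ] F} {p v : ℂ × ℂ} (hp : p ∈ SolidTorus)
    (h₁ : HasFDerivWithinAt f f₁ SolidTorus p) (h₂ : HasFDerivWithinAt f f₂ SolidTorus p)
    (hv : v ∈ STtan p) : f₁ v = f₂ v := by
  have hdisk : UniqueDiffWithinAt ℝ (Metric.closedBall (0 : ℂ) 1) p.1 :=
    uniqueDiffOn_convex (convex_closedBall 0 1)
      ⟨0, Metric.ball_subset_interior_closedBall (Metric.mem_ball_self one_pos)⟩ p.1
      (by simpa using hp.1)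
  have hmaps : MapsTo (fun z : ℂ => (z, p.2)) (Metric.closedBall 0 1) SolidTorus :=
    fun z hz => ⟨by simpa using hz, hp.2⟩
  have hinl := hdisk.eq
    (h₁.comp p.1 (hasFDerivAt_prodMk_left p.1 p.2).hasFDerivWithinAt hmaps)
    (h₂.comp p.1 (hasFDerivAt_prodMk_left p.1 p.2).hasFDerivWithinAt hmaps)
  have hcurve : HasDerivAt (fun t : ℝ => (p.1, p.2 * Complex.exp (t * Complex.I)))
      ((0 : ℂ), Complex.I * p.2) 0 := by
    have h : HasDerivAt (fun t : ℝ => p.2 * Complex.exp (t * Complex.I)) (Complex.I * p.2) 0 := by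
      simpa [mul_comm] using ((Complex.ofRealCLM.hasDerivAt (x := (0 : ℝ))).mul_const
        Complex.I).cexp.const_mul p.2
    exact (hasDerivAt_const (0 : ℝ) p.1).prodMk h
  have hev : ∀ t : ℝ, (p.1, p.2 * Complex.exp (t * Complex.I)) ∈ SolidTorus := fun t =>
    ⟨hp.1, by simp [hp.2]⟩
  have hp0 : p = (fun t : ℝ => (p.1, p.2 * Complex.exp (t * Complex.I))) 0 := by simp
  have hcirc : f₁ (0, Complex.I * p.2) = f₂ (0, Complex.I * p.2) := by
    rw [hp0] at h₁ h₂
    exact (h₁.comp_hasDerivAt 0 hcurve (.of_forall hev)).unique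
      (h₂.comp_hasDerivAt 0 hcurve (.of_forall hev))
  have hdec : v = (v.1, 0) + (inner ℝ (Complex.I * p.2) v.2 : ℝ) • (0, Complex.I * p.2) := by
    refine Prod.ext (by simp) ?_
    simpa using eq_smul_I_mul_of_inner_eq_zero hp.2 (mem_STtan.1 hv)
  have h1 : f₁ (v.1, 0) = f₂ (v.1, 0) := by simpa using DFunLike.congr_fun hinl v.1
  rw [hdec, map_add, map_add, map_smul, map_smul, h1, hcirc]

theorem HasFDerivWithinAt.fderivWithin_solidTorus {F : Type*} [NormedAddCommGroup F]
    [NormedSpace ℝ F] {f : ℂ × ℂ → F} {f' : ℂ × ℂ →L[ℝ] F} {p v : ℂ × ℂ}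
    (h : HasFDerivWithinAt f f' SolidTorus p) (hp : p ∈ SolidTorus) (hv : v ∈ STtan p) :
    fderivWithin ℝ f SolidTorus p v = f' v :=
  hasFDerivWithinAt_solidTorus_unique hp h.differentiableWithinAt.hasFDerivWithinAt h hv

theorem ContDiffOn.fderivWithin_solidTorus_apply {F : Type*} [NormedAddCommGroup F]
    [NormedSpace ℝ F] {Y : ℂ × ℂ → F} {X : ℂ × ℂ → ℂ × ℂ}
    (hY : ContDiffOn ℝ (⊤ : ℕ∞) Y SolidTorus) (hX : SmoothVFST X) :
    ContDiffOn ℝ (⊤ : ℕ∞) (fun p => fderivWithin ℝ Y SolidTorus p (X p)) SolidTorus := by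
  refine contDiffOn_infty.2 fun m p hp => ?_
  have hYp : ContDiffWithinAt ℝ ((m : WithTop ℕ∞) + 1) Y SolidTorus p := by
    have := contDiffOn_infty.1 hY (m + 1) p hp
    exact_mod_cast this
  obtain ⟨u, hu, -, -, Y', hY', hsm⟩ :=
    (contDiffWithinAt_succ_iff_hasFDerivWithinAt' (by simp)).1 hYp
  rw [insert_eq_of_mem hp] at hu
  refine (hsm.clm_apply (contDiffOn_infty.1 hX.1 m p hp)).congr_of_eventuallyEq_of_mem ?_ hp
  filter_upwards [hu, self_mem_nhdsWithin] with q hq hqS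
  exact (hY' q hq).fderivWithin_solidTorus hqS (hX.2 q hqS)

theorem SmoothVFST.differentiableWithinAt {X : ℂ × ℂ → ℂ × ℂ} (hX : SmoothVFST X) {p : ℂ × ℂ}
    (hp : p ∈ SolidTorus) : DifferentiableWithinAt ℝ X SolidTorus p :=
  (hX.1.differentiableOn (by simp)) p hp

/-- The smooth vector fields on the solid torus form a subspace. -/
def smoothFields : Submodule ℝ (ℂ × ℂ → ℂ × ℂ) where
  carrier := {V | SmoothVFST V}
  add_mem' h h' := ⟨h.1.add h'.1, fun p hp => (STtan p).add_mem (h.2 p hp) (h'.2 p hp)⟩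
  zero_mem' := ⟨contDiffOn_const, fun p _ => (STtan p).zero_mem⟩
  smul_mem' c _ h := ⟨h.1.const_smul c, fun p hp => (STtan p).smul_mem c (h.2 p hp)⟩

theorem SmoothVFST.smul {f : ℂ × ℂ → ℝ} {X : ℂ × ℂ → ℂ × ℂ} (hf : SmoothFST f)
    (hX : SmoothVFST X) : SmoothVFST (fun q => f q • X q) :=
  ⟨ContDiffOn.smul hf hX.1, fun p hp => (STtan p).smul_mem _ (hX.2 p hp)⟩

theorem exists_smoothFields_projection :
    ∃ P : (ℂ × ℂ → ℂ × ℂ) →ₗ[ℝ] (ℂ × ℂ → ℂ × ℂ),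
      (∀ V, SmoothVFST (P V)) ∧ ∀ V, SmoothVFST V → P V = V := by
  obtain ⟨P, hP⟩ := smoothFields.subtype.exists_leftInverse_of_injective
    smoothFields.ker_subtype
  exact ⟨smoothFields.subtype ∘ₗ P, fun V => (P V).2, fun V hV =>
    congrArg Subtype.val (DFunLike.congr_fun hP (⟨V, hV⟩ : smoothFields))⟩

/-- A linear projection of all vector fields onto the smooth ones. -/
def smoothProj : (ℂ × ℂ → ℂ × ℂ) →ₗ[ℝ] (ℂ × ℂ → ℂ × ℂ) :=
  exists_smoothFields_projection.choose

theorem smoothVFST_smoothProj (V : ℂ × ℂ → ℂ × ℂ) : SmoothVFST (smoothProj V) :=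
  exists_smoothFields_projection.choose_spec.1 V

theorem SmoothVFST.smoothProj_eq {V : ℂ × ℂ → ℂ × ℂ} (hV : SmoothVFST V) : smoothProj V = V :=
  exists_smoothFields_projection.choose_spec.2 V hV

/-- The conformal factor: a smooth function, positive on `[0, ∞)`, with `cylFactor s = s` for
`1/16 ≤ s`. The metric `|dz|² / cylFactor (|z|²)` on the plane is a capped-off cylinder. -/
def cylFactor (s : ℝ) : ℝ := s + expNegInvGlue (1 / 16 - s)

theorem contDiff_cylFactor : ContDiff ℝ (⊤ : ℕ∞) cylFactor :=
  contDiff_id.add (expNegInvGlue.contDiff.comp (contDiff_const.sub contDiff_id))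

theorem cylFactor_pos {s : ℝ} (hs : 0 ≤ s) : 0 < cylFactor s := by
  rcases hs.eq_or_lt with rfl | h
  · simpa [cylFactor] using expNegInvGlue.pos_of_pos (x := 16⁻¹) (by norm_num)
  · exact add_pos_of_pos_of_nonneg h (expNegInvGlue.nonneg _)

theorem cylFactor_of_le {s : ℝ} (hs : 1 / 16 ≤ s) : cylFactor s = s := by
  simp only [cylFactor, expNegInvGlue.zero_of_nonpos (sub_nonpos.2 hs), add_zero]

theorem hasDerivAt_cylFactor (s : ℝ) : HasDerivAt cylFactor (deriv cylFactor s) s :=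
  (contDiff_cylFactor.differentiable (by simp) s).hasDerivAt

theorem deriv_cylFactor_of_lt {s : ℝ} (hs : 1 / 16 < s) : deriv cylFactor s = 1 := by
  have h : cylFactor =ᶠ[nhds s] id := by
    filter_upwards [lt_mem_nhds hs] with x hx using cylFactor_of_le hx.le
  rw [h.deriv_eq, deriv_id]

theorem contDiff_deriv_cylFactor : ContDiff ℝ (⊤ : ℕ∞) (deriv cylFactor) :=
  (contDiff_infty_iff_deriv.1 contDiff_cylFactor).2

theorem contDiff_normSq_fst : ContDiff ℝ (⊤ : ℕ∞) (fun p : ℂ × ℂ => ‖p.1‖ ^ 2) :=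
  contDiff_fst.norm_sq ℝ

theorem HasDerivAt.comp_normSq_fst {φ : ℝ → ℝ} {φ' : ℝ} {p : ℂ × ℂ}
    (h : HasDerivAt φ φ' (‖p.1‖ ^ 2)) :
    HasFDerivAt (fun q : ℂ × ℂ => φ (‖q.1‖ ^ 2))
      (φ' • (2 • innerSL ℝ p.1) ∘L ContinuousLinearMap.fst ℝ ℂ ℂ) p :=
  h.comp_hasFDerivAt p
    ((hasStrictFDerivAt_norm_sq p.1).hasFDerivAt.comp p hasFDerivAt_fst)

/-- The product of the capped-off cylinder metric on the disk and the standard metric on the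
circle. -/
def cylMetric : RMetricST where
  g p := (cylFactor (‖p.1‖ ^ 2))⁻¹ •
      (innerₗ ℂ).compl₁₂ (LinearMap.fst ℝ ℂ ℂ) (LinearMap.fst ℝ ℂ ℂ)
    + (innerₗ ℂ).compl₁₂ (LinearMap.snd ℝ ℂ ℂ) (LinearMap.snd ℝ ℂ ℂ)
  symm p _ u v := by simp [real_inner_comm]
  posdef p _ v _ hv := by
    have hc := inv_pos.2 (cylFactor_pos (sq_nonneg ‖p.1‖))
    simp only [LinearMap.add_apply, LinearMap.smul_apply, LinearMap.compl₁₂_apply,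
      LinearMap.fst_apply, LinearMap.snd_apply, innerₗ_apply_apply, real_inner_self_eq_norm_sq,
      smul_eq_mul]
    by_cases h : v.1 = 0
    · have h2 : v.2 ≠ 0 := fun h2 => hv (Prod.ext h h2)
      have : 0 < ‖v.2‖ := norm_pos_iff.2 h2
      positivity
    · have : 0 < ‖v.1‖ := norm_pos_iff.2 h
      positivity
  smooth V W hV hW := by
    simp only [LinearMap.add_apply, LinearMap.smul_apply, LinearMap.compl₁₂_apply,
      LinearMap.fst_apply, LinearMap.snd_apply, innerₗ_apply_apply, smul_eq_mul]
    exact (((contDiff_cylFactor.comp contDiff_normSq_fst).inv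
      fun p => (cylFactor_pos (sq_nonneg ‖p.1‖)).ne').contDiffOn.mul
        (hV.1.fst.inner ℝ hW.1.fst)).add (hV.1.snd.inner ℝ hW.1.snd)

theorem cylMetric_apply (p u v : ℂ × ℂ) :
    cylMetric.g p u v = (cylFactor (‖p.1‖ ^ 2))⁻¹ * inner ℝ u.1 v.1 + inner ℝ u.2 v.2 := by
  simp [cylMetric]

/-- The Christoffel tensor of `cylMetric` relative to the flat connection of `ℂ × ℂ`: the
conformal correction in the disk factor and the normal projection in the circle factor. -/
def cylChristoffel (p u v : ℂ × ℂ) : ℂ × ℂ :=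
  ((-(deriv cylFactor (‖p.1‖ ^ 2) / cylFactor (‖p.1‖ ^ 2))) •
      ((inner ℝ p.1 u.1 : ℝ) • v.1 + (inner ℝ p.1 v.1 : ℝ) • u.1 - (inner ℝ u.1 v.1 : ℝ) • p.1),
    (inner ℝ u.2 v.2 : ℝ) • p.2)

theorem cylChristoffel_comm (p u v : ℂ × ℂ) : cylChristoffel p u v = cylChristoffel p v u := by
  simp only [cylChristoffel, real_inner_comm u.1 v.1, real_inner_comm u.2 v.2,
    add_comm ((inner ℝ p.1 u.1 : ℝ) • v.1)]

theorem cylChristoffel_add_left (p u u' v : ℂ × ℂ) :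
    cylChristoffel p (u + u') v = cylChristoffel p u v + cylChristoffel p u' v := by
  refine Prod.ext ?_ ?_ <;>
    simp only [cylChristoffel, Prod.fst_add, Prod.snd_add, inner_add_left, inner_add_right] <;>
    module

theorem cylChristoffel_add_right (p u v v' : ℂ × ℂ) :
    cylChristoffel p u (v + v') = cylChristoffel p u v + cylChristoffel p u v' := by
  simp only [cylChristoffel_comm p u, cylChristoffel_add_left]

theorem cylChristoffel_smul_left (p u v : ℂ × ℂ) (c : ℝ) :
    cylChristoffel p (c • u) v = c • cylChristoffel p u v := by
  refine Prod.ext ?_ ?_ <;>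
    simp only [cylChristoffel, Prod.smul_fst, Prod.smul_snd, real_inner_smul_left,
      real_inner_smul_right] <;>
    module

theorem cylChristoffel_smul_right (p u v : ℂ × ℂ) (c : ℝ) :
    cylChristoffel p u (c • v) = c • cylChristoffel p u v := by
  simp only [cylChristoffel_comm p u, cylChristoffel_smul_left]

theorem SmoothVFST.cylChristoffel {X Y : ℂ × ℂ → ℂ × ℂ} (hX : SmoothVFST X)
    (hY : SmoothVFST Y) :
    ContDiffOn ℝ (⊤ : ℕ∞) (fun p => cylChristoffel p (X p) (Y p)) SolidTorus := by
  have hX1 := hX.1.fst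
  have hY1 := hY.1.fst
  have h1 : ContDiffOn ℝ (⊤ : ℕ∞) (fun p : ℂ × ℂ => p.1) SolidTorus := contDiff_fst.contDiffOn
  have h2 : ContDiffOn ℝ (⊤ : ℕ∞) (fun p : ℂ × ℂ => p.2) SolidTorus := contDiff_snd.contDiffOn
  have hfac : ContDiffOn ℝ (⊤ : ℕ∞) (fun p : ℂ × ℂ =>
      -(deriv cylFactor (‖p.1‖ ^ 2) / cylFactor (‖p.1‖ ^ 2))) SolidTorus :=
    ((contDiff_deriv_cylFactor.comp contDiff_normSq_fst).div
      (contDiff_cylFactor.comp contDiff_normSq_fst)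
        fun p => (cylFactor_pos (sq_nonneg ‖p.1‖)).ne').neg.contDiffOn
  exact (hfac.smul ((((h1.inner ℝ hX1).smul hY1).add ((h1.inner ℝ hY1).smul hX1)).sub
    ((hX1.inner ℝ hY1).smul h1))).prodMk ((hX.1.snd.inner ℝ hY.1.snd).smul h2)

/-- The Levi-Civita derivative of `cylMetric` on smooth vector fields. -/
def cylCov (X Y : ℂ × ℂ → ℂ × ℂ) (p : ℂ × ℂ) : ℂ × ℂ :=
  fderivWithin ℝ Y SolidTorus p (X p) + cylChristoffel p (X p) (Y p)

theorem inner_fderivWithin_snd {X Y : ℂ × ℂ → ℂ × ℂ} (hX : SmoothVFST X) (hY : SmoothVFST Y)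
    {p : ℂ × ℂ} (hp : p ∈ SolidTorus) :
    inner ℝ p.2 (fderivWithin ℝ Y SolidTorus p (X p)).2 + inner ℝ (X p).2 (Y p).2 = 0 := by
  have hY' := (hY.differentiableWithinAt hp).hasFDerivWithinAt
  have h := (hasFDerivAt_snd (𝕜 := ℝ) (p := p)).hasFDerivWithinAt (s := SolidTorus) |>.inner ℝ
    (hasFDerivAt_snd.comp_hasFDerivWithinAt p hY')
  have h0 : HasFDerivWithinAt (fun q : ℂ × ℂ => inner ℝ q.2 (Y q).2) (0 : ℂ × ℂ →L[ℝ] ℝ)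
      SolidTorus p :=
    (hasFDerivWithinAt_const (0 : ℝ) p SolidTorus).congr
      (fun q hq => mem_STtan.1 (hY.2 q hq)) (mem_STtan.1 (hY.2 p hp))
  simpa using hasFDerivWithinAt_solidTorus_unique hp h h0 (hX.2 p hp)

theorem SmoothVFST.cylCov {X Y : ℂ × ℂ → ℂ × ℂ} (hX : SmoothVFST X) (hY : SmoothVFST Y) :
    SmoothVFST (cylCov X Y) := by
  refine ⟨(hY.1.fderivWithin_solidTorus_apply hX).add (hX.cylChristoffel hY), fun p hp => ?_⟩
  rw [mem_STtan, ← inner_fderivWithin_snd hX hY hp]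
  simp only [_root_.cylCov, _root_.cylChristoffel, Prod.snd_add, inner_add_right,
    real_inner_smul_right, real_inner_self_eq_norm_sq, hp.2, one_pow, mul_one]

theorem cylCov_compat {X Y Z : ℂ × ℂ → ℂ × ℂ} (hX : SmoothVFST X) (hY : SmoothVFST Y)
    (hZ : SmoothVFST Z) {p : ℂ × ℂ} (hp : p ∈ SolidTorus) :
    fderivWithin ℝ (fun q => cylMetric.g q (Y q) (Z q)) SolidTorus p (X p)
      = cylMetric.g p (cylCov X Y p) (Z p) + cylMetric.g p (Y p) (cylCov X Z p) := by
  have hY' := (hY.differentiableWithinAt hp).hasFDerivWithinAt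
  have hZ' := (hZ.differentiableWithinAt hp).hasFDerivWithinAt
  have hc := cylFactor_pos (sq_nonneg ‖p.1‖)
  have hfac := ((hasDerivAt_cylFactor (‖p.1‖ ^ 2)).inv hc.ne').comp_normSq_fst.hasFDerivWithinAt
    (s := SolidTorus)
  have h1 := (hasFDerivAt_fst (𝕜 := ℝ).comp_hasFDerivWithinAt p hY').inner ℝ
    (hasFDerivAt_fst (𝕜 := ℝ).comp_hasFDerivWithinAt p hZ')
  have h2 := (hasFDerivAt_snd (𝕜 := ℝ).comp_hasFDerivWithinAt p hY').inner ℝ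
    (hasFDerivAt_snd (𝕜 := ℝ).comp_hasFDerivWithinAt p hZ')
  have h := ((hfac.mul h1).add h2).fderivWithin_solidTorus hp (hX.2 p hp)
  have hYt := mem_STtan.1 (hY.2 p hp)
  have hZt := mem_STtan.1 (hZ.2 p hp)
  rw [real_inner_comm] at hYt
  simp only [cylMetric_apply]
  refine h.trans ?_
  simp only [cylCov, cylChristoffel, Prod.fst_add, Prod.snd_add, inner_add_left,
    inner_add_right, inner_sub_left, inner_sub_right, real_inner_smul_left,
    real_inner_smul_right, hYt, hZt]
  simp [real_inner_comm]
  field_simp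
  ring

/-- The Levi-Civita connection of `cylMetric`. -/
def cylConnection : LeviCivitaST cylMetric where
  cov X Y := cylCov (smoothProj X) (smoothProj Y)
  smooth_cov X Y _ _ := (smoothVFST_smoothProj X).cylCov (smoothVFST_smoothProj Y)
  add_left X X' Y p _ := by
    have h : smoothProj (fun q => X q + X' q) = smoothProj X + smoothProj X' :=
      map_add smoothProj X X'
    simp only [h, cylCov, Pi.add_apply, map_add, cylChristoffel_add_left]
    abel
  smul_left f X Y hf hX hY p _ := by
    rw [hX.smoothProj_eq, hY.smoothProj_eq, (hX.smul hf).smoothProj_eq]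
    simp only [cylCov, map_smul, cylChristoffel_smul_left, smul_add]
  add_right X Y Y' p hp := by
    have h : smoothProj (fun q => Y q + Y' q) = smoothProj Y + smoothProj Y' :=
      map_add smoothProj Y Y'
    have hd := (((smoothVFST_smoothProj Y).differentiableWithinAt hp).hasFDerivWithinAt.add
      ((smoothVFST_smoothProj Y').differentiableWithinAt hp).hasFDerivWithinAt
        ).fderivWithin_solidTorus hp ((smoothVFST_smoothProj X).2 p hp)
    simp only [h, cylCov, Pi.add_apply, hd, _root_.add_apply,
      cylChristoffel_add_right]
    abel
  leibniz f X Y hf hX hY p hp := by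
    rw [hX.smoothProj_eq, hY.smoothProj_eq, (hY.smul hf).smoothProj_eq]
    have hf' := (ContDiffOn.differentiableOn hf (by simp) p hp).hasFDerivWithinAt
    have hd := (hf'.smul (hY.differentiableWithinAt hp).hasFDerivWithinAt
      ).fderivWithin_solidTorus hp (hX.2 p hp)
    simp only [cylCov, cylChristoffel_smul_right, smul_add]
    rw [show (fun q => f q • Y q) = f • Y from rfl, hd]
    simp
    abel
  compat X Y Z hX hY hZ p hp := by
    rw [hX.smoothProj_eq, hY.smoothProj_eq, hZ.smoothProj_eq]
    exact cylCov_compat hX hY hZ hp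
  torsion_free X Y hX hY p _ := by
    rw [hX.smoothProj_eq, hY.smoothProj_eq]
    simp only [cylCov, cylChristoffel_comm p (X p)]
    abel

/-- The profile of the foliation, as a function of `s = r²`. -/
def reebProfile (s : ℝ) : ℝ := Real.smoothTransition (3 * s - 1 / 3)

theorem contDiff_reebProfile : ContDiff ℝ (⊤ : ℕ∞) reebProfile :=
  Real.smoothTransition.contDiff.comp ((contDiff_const.mul contDiff_id).sub contDiff_const)

theorem reebProfile_nonneg (s : ℝ) : 0 ≤ reebProfile s := Real.smoothTransition.nonneg _

theorem reebProfile_of_le {s : ℝ} (hs : s ≤ 1 / 9) : reebProfile s = 0 :=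
  Real.smoothTransition.zero_of_nonpos (by linarith)

theorem reebProfile_of_ge {s : ℝ} (hs : 4 / 9 ≤ s) : reebProfile s = 1 :=
  Real.smoothTransition.one_of_one_le (by linarith)

theorem expNegInvGlue_lt_of_lt {x y : ℝ} (hy : 0 < y) (h : x < y) :
    expNegInvGlue x < expNegInvGlue y := by
  rcases le_or_gt x 0 with hx | hx
  · simpa only [expNegInvGlue.zero_of_nonpos hx] using expNegInvGlue.pos_of_pos hy
  · simp only [expNegInvGlue, not_le.2 hx, not_le.2 hy, if_false]
    exact Real.exp_lt_exp.2 (neg_lt_neg (inv_strictAnti₀ hx h))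

theorem strictMonoOn_smoothTransition : StrictMonoOn Real.smoothTransition (Icc 0 1) := by
  intro x hx y hy hxy
  have h1 := expNegInvGlue_lt_of_lt (hx.1.trans_lt hxy) hxy
  have h2 := expNegInvGlue_lt_of_lt (x := 1 - y) (y := 1 - x) (by linarith [hy.2]) (by linarith)
  simp only [Real.smoothTransition]
  rw [div_lt_div_iff₀ (Real.smoothTransition.pos_denom x) (Real.smoothTransition.pos_denom y)]
  nlinarith [expNegInvGlue.nonneg x, expNegInvGlue.nonneg (1 - y)]

theorem strictMonoOn_reebProfile_sq :
    StrictMonoOn (fun r : ℝ => reebProfile (r ^ 2)) (Ioc (1 / 3) (2 / 3)) := by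
  intro x hx y hy hxy
  have hx1 := hx.1
  have hy2 := hy.2
  apply strictMonoOn_smoothTransition
  · constructor <;> nlinarith
  · constructor <;> nlinarith
  · nlinarith

/-- The squared `cylMetric`-norm of the Reeb form, as a function of `s = r²`. -/
def reebNormSq (s : ℝ) : ℝ := reebProfile s ^ 2 * cylFactor s + (1 - reebProfile s) ^ 2

theorem reebNormSq_pos {s : ℝ} (hs : 0 ≤ s) : 0 < reebNormSq s := by
  have hc := cylFactor_pos hs
  unfold reebNormSq
  rcases eq_or_ne (reebProfile s) 0 with h | h
  · simp [h]
  · positivity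

/-- The radial coefficient of the unit normal. -/
def normalDisk (s : ℝ) : ℝ := reebProfile s * √(cylFactor s) / √(reebNormSq s)

/-- The circle coefficient of the unit normal. -/
def normalCircle (s : ℝ) : ℝ := (1 - reebProfile s) / √(reebNormSq s)

theorem contDiff_reebNormSq : ContDiff ℝ (⊤ : ℕ∞) reebNormSq :=
  ((contDiff_reebProfile.pow 2).mul contDiff_cylFactor).add
    ((contDiff_const.sub contDiff_reebProfile).pow 2)

theorem contDiffAt_normalDisk {s : ℝ} (hs : 0 ≤ s) : ContDiffAt ℝ (⊤ : ℕ∞) normalDisk s :=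
  (contDiff_reebProfile.contDiffAt.mul
    (contDiff_cylFactor.contDiffAt.sqrt (cylFactor_pos hs).ne')).div
    (contDiff_reebNormSq.contDiffAt.sqrt (reebNormSq_pos hs).ne')
    (Real.sqrt_pos.2 (reebNormSq_pos hs)).ne'

theorem contDiffAt_normalCircle {s : ℝ} (hs : 0 ≤ s) : ContDiffAt ℝ (⊤ : ℕ∞) normalCircle s :=
  (contDiff_const.sub contDiff_reebProfile).contDiffAt.div
    (contDiff_reebNormSq.contDiffAt.sqrt (reebNormSq_pos hs).ne')
    (Real.sqrt_pos.2 (reebNormSq_pos hs)).ne'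

theorem normalDisk_of_le {s : ℝ} (hs : s ≤ 1 / 9) : normalDisk s = 0 := by
  simp [normalDisk, reebProfile_of_le hs]

theorem deriv_normalDisk_of_le {s : ℝ} (hs : s ≤ 1 / 9) : deriv normalDisk s = 0 := by
  refine IsLocalMin.deriv_eq_zero (.of_forall fun t => ?_)
  rw [normalDisk_of_le hs]
  have := reebProfile_nonneg t
  unfold normalDisk
  positivity

/-- The unit normal field of the Reeb foliation for `cylMetric`. -/
def reebNormal (p : ℂ × ℂ) : ℂ × ℂ :=
  (normalDisk (‖p.1‖ ^ 2) • p.1, normalCircle (‖p.1‖ ^ 2) • (Complex.I * p.2))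

theorem inner_I_mul_self (w : ℂ) : inner ℝ w (Complex.I * w) = 0 := by
  rw [complex_inner_eq]; simp; ring

theorem smoothVFST_reebNormal : SmoothVFST reebNormal := by
  constructor
  · refine ContDiff.contDiffOn (contDiff_iff_contDiffAt.2 fun p => ?_)
    have ha := (contDiffAt_normalDisk (sq_nonneg ‖p.1‖)).comp p contDiff_normSq_fst.contDiffAt
    have hb := (contDiffAt_normalCircle (sq_nonneg ‖p.1‖)).comp p contDiff_normSq_fst.contDiffAt
    exact (ha.smul contDiffAt_fst).prodMk (hb.smul (contDiffAt_const.mul contDiffAt_snd))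
  · intro p _
    rw [mem_STtan, reebNormal, real_inner_smul_right, inner_I_mul_self, mul_zero]

theorem mem_reebPlanes {f : ℝ → ℝ} {p v : ℂ × ℂ} : v ∈ reebPlanes f p ↔
    inner ℝ p.2 v.2 = 0 ∧ f ‖p.1‖ / ‖p.1‖ * inner ℝ p.1 v.1
      + (1 - f ‖p.1‖) * inner ℝ (Complex.I * p.2) v.2 = 0 := by
  rw [reebPlanes, Submodule.mem_inf, mem_STtan]
  simp only [reebForm, LinearMap.mem_ker, LinearMap.add_apply, LinearMap.smul_apply,
    LinearMap.comp_apply, LinearMap.fst_apply, LinearMap.snd_apply, rIPL_apply, smul_eq_mul]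

theorem isUnitNormalST_reebNormal :
    IsUnitNormalST cylMetric (reebPlanes fun r => reebProfile (r ^ 2)) reebNormal := by
  refine ⟨smoothVFST_reebNormal, fun p hp => ?_⟩
  have hs := sq_nonneg ‖p.1‖
  have hc := cylFactor_pos hs
  have hD := reebNormSq_pos hs
  have hDs := Real.sq_sqrt hD.le
  have hD0 := Real.sqrt_pos.2 hD
  have hcyl : reebProfile (‖p.1‖ ^ 2) = 0 ∨ cylFactor (‖p.1‖ ^ 2) = ‖p.1‖ ^ 2 := by
    rcases le_total (‖p.1‖ ^ 2) (1 / 9) with h | h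
    · exact .inl (reebProfile_of_le h)
    · exact .inr (cylFactor_of_le (by linarith))
  constructor
  · simp only [cylMetric_apply, reebNormal, real_inner_self_eq_norm_sq, norm_smul, mul_pow,
      Real.norm_eq_abs, sq_abs, norm_mul, Complex.norm_I, hp.2, normalDisk, normalCircle]
    rcases hcyl with h | h
    · have h1 : reebNormSq (‖p.1‖ ^ 2) = 1 := by simp [reebNormSq, h]
      simp [h, h1]
    · have h1 : reebNormSq (‖p.1‖ ^ 2) =
          reebProfile (‖p.1‖ ^ 2) ^ 2 * ‖p.1‖ ^ 2 + (1 - reebProfile (‖p.1‖ ^ 2)) ^ 2 := by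
        rw [reebNormSq, h]
      rw [h] at hc ⊢
      have hz : ‖p.1‖ ≠ 0 := fun h0 => by simp [h0] at hc
      rw [Real.sqrt_sq (norm_nonneg _)]
      field_simp
      rw [hDs, h1]
      ring
  · intro v hv
    have hv2 := (mem_reebPlanes.1 hv).2
    simp only [cylMetric_apply, reebNormal, real_inner_smul_left, normalDisk, normalCircle]
    rcases hcyl with h | h
    · simp only [h, zero_div, zero_mul, zero_add, sub_zero, one_mul] at hv2
      simp [h, hv2]
    · rw [h] at hc ⊢
      have hz : ‖p.1‖ ≠ 0 := fun h0 => by simp [h0] at hc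
      rw [Real.sqrt_sq (norm_nonneg _)]
      field_simp at hv2 ⊢
      linear_combination hv2

theorem hasFDerivAt_reebNormal (p : ℂ × ℂ) : ∃ N : ℂ × ℂ →L[ℝ] ℂ × ℂ,
    HasFDerivAt reebNormal N p ∧ ∀ u, N u =
      ((2 * deriv normalDisk (‖p.1‖ ^ 2) * inner ℝ p.1 u.1) • p.1
          + normalDisk (‖p.1‖ ^ 2) • u.1,
        (2 * deriv normalCircle (‖p.1‖ ^ 2) * inner ℝ p.1 u.1) • (Complex.I * p.2)
          + normalCircle (‖p.1‖ ^ 2) • (Complex.I * u.2)) := by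
  have ha := ((contDiffAt_normalDisk (sq_nonneg ‖p.1‖)).differentiableAt
    (by simp)).hasDerivAt.comp_normSq_fst
  have hb := ((contDiffAt_normalCircle (sq_nonneg ‖p.1‖)).differentiableAt
    (by simp)).hasDerivAt.comp_normSq_fst
  have hsnd : HasFDerivAt (fun q : ℂ × ℂ => Complex.I * q.2)
      (Complex.I • ContinuousLinearMap.snd ℝ ℂ ℂ) p := hasFDerivAt_snd.const_mul Complex.I
  refine ⟨_, (ha.smul hasFDerivAt_fst).prodMk (hb.smul hsnd), fun u => ?_⟩
  refine Prod.ext ?_ ?_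
  · simp
    ring
  · simp
    ring

/-- The shape operator of the Reeb foliation. -/
theorem cylMetric_cylCov_reebNormal {X : ℂ × ℂ → ℂ × ℂ} (hX : SmoothVFST X) {p v : ℂ × ℂ}
    (hp : p ∈ SolidTorus) (hv : v ∈ STtan p) :
    cylMetric.g p v (cylCov X reebNormal p) = 2 * inner ℝ p.1 (X p).1 *
      ((cylFactor (‖p.1‖ ^ 2))⁻¹ * deriv normalDisk (‖p.1‖ ^ 2) * inner ℝ p.1 v.1
        + deriv normalCircle (‖p.1‖ ^ 2) * inner ℝ (Complex.I * p.2) v.2) := by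
  obtain ⟨N, hN, hNu⟩ := hasFDerivAt_reebNormal p
  have hXt := mem_STtan.1 (hX.2 p hp)
  have hvt := mem_STtan.1 hv
  have hIu : inner ℝ v.2 (Complex.I * (X p).2) = 0 := by
    obtain ⟨τ, hτ⟩ : ∃ τ : ℝ, (X p).2 = τ • (Complex.I * p.2) :=
      ⟨_, eq_smul_I_mul_of_inner_eq_zero hp.2 hXt⟩
    rw [complex_inner_eq] at hvt
    rw [hτ, complex_inner_eq]
    simp
    linear_combination (-τ) * hvt
  have hz : normalDisk (‖p.1‖ ^ 2) *
      (1 - deriv cylFactor (‖p.1‖ ^ 2) / cylFactor (‖p.1‖ ^ 2) * ‖p.1‖ ^ 2) = 0 := by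
    rcases le_total (‖p.1‖ ^ 2) (1 / 9) with h | h
    · rw [normalDisk_of_le h, zero_mul]
    · rw [deriv_cylFactor_of_lt (by linarith), cylFactor_of_le (by linarith),
        one_div_mul_cancel (by linarith), sub_self, mul_zero]
  rw [real_inner_comm] at hvt
  rw [cylMetric_apply, cylCov, hN.hasFDerivWithinAt.fderivWithin_solidTorus hp (hX.2 p hp), hNu]
  simp only [cylChristoffel, reebNormal, Prod.fst_add, Prod.snd_add, inner_add_right,
    inner_sub_right, real_inner_smul_right, hIu, hvt, real_inner_self_eq_norm_sq,
    real_inner_comm p.1, real_inner_comm (Complex.I * p.2)]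
  linear_combination ((cylFactor (‖p.1‖ ^ 2))⁻¹ * inner ℝ v.1 (X p).1) * hz

theorem cylMetric_cylCov_eq_neg {ξ : ℂ × ℂ → Submodule ℝ (ℂ × ℂ)} {n S T : ℂ × ℂ → ℂ × ℂ}
    (hn : IsUnitNormalST cylMetric ξ n) {p : ℂ × ℂ} (hp : p ∈ SolidTorus)
    {U : Set (ℂ × ℂ)} (hU : IsOpen U) (hpU : p ∈ U) (hS : SmoothVFST S) (hT : SmoothVFST T)
    (hTξ : ∀ y ∈ SolidTorus ∩ U, T y ∈ ξ y) :
    cylMetric.g p (cylCov S T p) (n p) = -cylMetric.g p (T p) (cylCov S n p) := by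
  have hzero : ∀ q ∈ SolidTorus ∩ U, cylMetric.g q (T q) (n q) = 0 := fun q hq => by
    rw [cylMetric.symm q hq.1, (hn.2 q hq.1).2 _ (hTξ q hq)]
  have hev : (fun q => cylMetric.g q (T q) (n q)) =ᶠ[nhdsWithin p SolidTorus] fun _ => 0 := by
    filter_upwards [self_mem_nhdsWithin, mem_nhdsWithin_of_mem_nhds (hU.mem_nhds hpU)]
      with q hq hqU using hzero q ⟨hq, hqU⟩
  have h := cylCov_compat hS hT hn.1 hp
  rw [hev.fderivWithin_eq (hzero p ⟨hp, hpU⟩), fderivWithin_const_apply] at h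
  exact eq_neg_of_add_eq_zero_left h.symm

theorem sffST_reebNormal {S T : ℂ × ℂ → ℂ × ℂ} {p : ℂ × ℂ} (hp : p ∈ SolidTorus)
    {U : Set (ℂ × ℂ)} (hU : IsOpen U) (hpU : p ∈ U) (hS : SmoothVFST S) (hT : SmoothVFST T)
    (hSξ : ∀ y ∈ SolidTorus ∩ U, S y ∈ reebPlanes (fun r => reebProfile (r ^ 2)) y)
    (hTξ : ∀ y ∈ SolidTorus ∩ U, T y ∈ reebPlanes (fun r => reebProfile (r ^ 2)) y) :
    sffST cylMetric cylConnection reebNormal S T p =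
      -(inner ℝ p.1 (S p).1 *
          ((cylFactor (‖p.1‖ ^ 2))⁻¹ * deriv normalDisk (‖p.1‖ ^ 2) * inner ℝ p.1 (T p).1
            + deriv normalCircle (‖p.1‖ ^ 2) * inner ℝ (Complex.I * p.2) (T p).2)
        + inner ℝ p.1 (T p).1 *
          ((cylFactor (‖p.1‖ ^ 2))⁻¹ * deriv normalDisk (‖p.1‖ ^ 2) * inner ℝ p.1 (S p).1
            + deriv normalCircle (‖p.1‖ ^ 2) * inner ℝ (Complex.I * p.2) (S p).2)) := by
  have hn := isUnitNormalST_reebNormal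
  simp only [sffST, cylConnection, hS.smoothProj_eq, hT.smoothProj_eq]
  rw [cylMetric_cylCov_eq_neg hn hp hU hpU hS hT hTξ,
    cylMetric_cylCov_eq_neg hn hp hU hpU hT hS hSξ,
    cylMetric_cylCov_reebNormal hS hp (hT.2 p hp), cylMetric_cylCov_reebNormal hT hp (hS.2 p hp)]
  ring

theorem extCurvEqST_reebPlanes : ExtCurvEqST cylMetric cylConnection reebNormal
    (reebPlanes fun r => reebProfile (r ^ 2)) fun _ => 0 := by
  intro p hp U hU hpU S T hS hT hSξ hTξ _
  rw [sffST_reebNormal hp hU hpU hS hS hSξ hSξ, sffST_reebNormal hp hU hpU hT hT hTξ hTξ,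
    sffST_reebNormal hp hU hpU hS hT hSξ hTξ, zero_mul]
  have hS2 := (mem_reebPlanes.1 (hSξ p ⟨hp, hpU⟩)).2
  have hT2 := (mem_reebPlanes.1 (hTξ p ⟨hp, hpU⟩)).2
  have hdet : (inner ℝ p.1 (S p).1 * inner ℝ (Complex.I * p.2) (T p).2
      - inner ℝ p.1 (T p).1 * inner ℝ (Complex.I * p.2) (S p).2 : ℝ) = 0 := by
    by_cases hq : 1 - reebProfile (‖p.1‖ ^ 2) = 0
    · have h1 : reebProfile (‖p.1‖ ^ 2) = 1 := by linarith
      have hz : ‖p.1‖ ≠ 0 := fun h0 => by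
        rw [h0, reebProfile_of_le (by norm_num)] at h1
        exact zero_ne_one h1
      have hx : ∀ x : ℝ, 1 / ‖p.1‖ * x + 0 = 0 → x = 0 := fun x hx => by
        simpa [hz] using hx
      rw [h1, sub_self, zero_mul] at hS2 hT2
      rw [hx _ hS2, hx _ hT2]
      ring
    · apply mul_left_cancel₀ hq
      linear_combination inner ℝ p.1 (S p).1 * hT2 - inner ℝ p.1 (T p).1 * hS2
  linear_combination (-(deriv normalCircle (‖p.1‖ ^ 2)) ^ 2 *
    (inner ℝ p.1 (S p).1 * inner ℝ (Complex.I * p.2) (T p).2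
      - inner ℝ p.1 (T p).1 * inner ℝ (Complex.I * p.2) (S p).2)) * hdet

theorem reebPlanes_of_norm_le {p : ℂ × ℂ} (hp : p ∈ SolidTorus) (h : ‖p.1‖ ≤ 1 / 3) :
    reebPlanes (fun r => reebProfile (r ^ 2)) p
      = (⊤ : Submodule ℝ ℂ).prod (⊥ : Submodule ℝ ℂ) := by
  have hψ : reebProfile (‖p.1‖ ^ 2) = 0 :=
    reebProfile_of_le (by nlinarith [norm_nonneg p.1])
  ext v
  simp only [mem_reebPlanes, hψ, Submodule.mem_prod, Submodule.mem_top, Submodule.mem_bot,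
    true_and, zero_div, zero_mul, zero_add, sub_zero, one_mul]
  refine ⟨fun hv => ?_, fun hv => by simp [hv]⟩
  rw [eq_smul_I_mul_of_inner_eq_zero hp.2 hv.1, hv.2, zero_smul]

theorem reebPlanes_of_le_norm {p : ℂ × ℂ} (h : 2 / 3 ≤ ‖p.1‖) :
    reebPlanes (fun r => reebProfile (r ^ 2)) p
      = LinearMap.ker ((rIPL p.1).comp (LinearMap.fst ℝ ℂ ℂ)) ⊓ STtan p := by
  have hψ : reebProfile (‖p.1‖ ^ 2) = 1 := reebProfile_of_ge (by nlinarith)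
  have hz : ‖p.1‖ ≠ 0 := by linarith
  ext v
  simp only [mem_reebPlanes, hψ, Submodule.mem_inf, mem_STtan, LinearMap.mem_ker,
    LinearMap.comp_apply, LinearMap.fst_apply, rIPL_apply, sub_self, zero_mul, add_zero,
    mul_eq_zero, one_div, inv_eq_zero, hz, false_or]
  exact and_comm

theorem totallyGeodesicAtST_of_norm_le {p : ℂ × ℂ} (hp : p ∈ SolidTorus) (h : ‖p.1‖ ≤ 1 / 3) :
    TotallyGeodesicAtST cylMetric cylConnection reebNormal
      (reebPlanes fun r => reebProfile (r ^ 2)) p := by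
  intro U hU hpU S T hS hT hSξ hTξ
  have hs : ‖p.1‖ ^ 2 ≤ 1 / 9 := by nlinarith [norm_nonneg p.1]
  have hS2 := hSξ p ⟨hp, hpU⟩
  have hT2 := hTξ p ⟨hp, hpU⟩
  rw [reebPlanes_of_norm_le hp h, Submodule.mem_prod, Submodule.mem_bot] at hS2 hT2
  simp [sffST_reebNormal hp hU hpU hS hT hSξ hTξ, deriv_normalDisk_of_le hs, hS2.2, hT2.2]

theorem totallyGeodesicAtST_of_le_norm {p : ℂ × ℂ} (hp : p ∈ SolidTorus) (h : 2 / 3 ≤ ‖p.1‖) :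
    TotallyGeodesicAtST cylMetric cylConnection reebNormal
      (reebPlanes fun r => reebProfile (r ^ 2)) p := by
  intro U hU hpU S T hS hT hSξ hTξ
  have hS2 := hSξ p ⟨hp, hpU⟩
  have hT2 := hTξ p ⟨hp, hpU⟩
  rw [reebPlanes_of_le_norm h, Submodule.mem_inf, LinearMap.mem_ker, LinearMap.comp_apply,
    LinearMap.fst_apply, rIPL_apply] at hS2 hT2
  rw [sffST_reebNormal hp hU hpU hS hT hSξ hTξ, hS2.1, hT2.1, zero_mul, zero_mul, add_zero,
    neg_zero]

/-- **Krouglov, Lemma 4.2 (Bolotov).** There are a foliation `F` and a Riemannian metric `g`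
on the solid torus `D² × S¹` such that `F` is parabolic with respect to `g`, the restriction
of `F` to `D²(1/3) × S¹` is the foliation by the totally geodesic disks `D²(1/3) × {t}`, and
the restriction of `F` to `([2/3,1] × S¹) × S¹` is the foliation by the totally geodesic
tori `{r} × S¹ × S¹`. The foliation is the 'thick' Reeb foliation defined by the kernel of
the 1-form `α = f(r) dr + (1 - f(r)) dt`, where `f` is a smooth function on `[0,1]` which
vanishes on `[0,1/3]`, is strictly increasing on `(1/3,2/3]` and equals `1` on `(2/3,1]`
(so that `F` has a Reeb component on a middle solid torus and is a product foliation by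
tori outside it). -/
theorem solid_torus_parabolic_reeb_foliation :
    ∃ f : ℝ → ℝ, ContDiff ℝ (⊤ : ℕ∞) f ∧
      (∀ r ∈ Icc (0:ℝ) (1/3), f r = 0) ∧
      StrictMonoOn f (Ioc (1/3:ℝ) (2/3)) ∧
      (∀ r ∈ Ioc (2/3:ℝ) 1, f r = 1) ∧
      ∃ gm : RMetricST, ∃ lc : LeviCivitaST gm, ∃ n : ℂ × ℂ → ℂ × ℂ,
        IsUnitNormalST gm (reebPlanes f) n ∧
        -- (1) the foliation is parabolic with respect to `g`
        ExtCurvEqST gm lc n (reebPlanes f) (fun _ => 0) ∧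
        -- (2) on `D²(1/3) × S¹` it is the foliation by the (totally geodesic) disks
        --     `D²(1/3) × {t}` …
        (∀ p ∈ SolidTorus, ‖p.1‖ ≤ 1/3 →
          reebPlanes f p = (⊤ : Submodule ℝ ℂ).prod (⊥ : Submodule ℝ ℂ) ∧
          TotallyGeodesicAtST gm lc n (reebPlanes f) p) ∧
        -- … and on `([2/3,1] × S¹) × S¹` it is the foliation by the (totally geodesic)
        --     tori `{r} × S¹ × S¹`
        (∀ p ∈ SolidTorus, 2/3 ≤ ‖p.1‖ →
          reebPlanes f p
            = LinearMap.ker ((rIPL p.1).comp (LinearMap.fst ℝ ℂ ℂ)) ⊓ STtan p ∧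
          TotallyGeodesicAtST gm lc n (reebPlanes f) p) := by
  refine ⟨fun r => reebProfile (r ^ 2), contDiff_reebProfile.comp (contDiff_id.pow 2),
    fun r hr => reebProfile_of_le (by nlinarith [hr.1, hr.2]), strictMonoOn_reebProfile_sq,
    fun r hr => reebProfile_of_ge (by nlinarith [hr.1]), cylMetric, cylConnection, reebNormal,
    isUnitNormalST_reebNormal, extCurvEqST_reebPlanes, fun p hp h => ⟨?_, ?_⟩,
    fun p hp h => ⟨?_, ?_⟩⟩
  · exact reebPlanes_of_norm_le hp h
  · exact totallyGeodesicAtST_of_norm_le hp h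
  · exact reebPlanes_of_le_norm h
  · exact totallyGeodesicAtST_of_le_norm hp h
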